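/- arXiv:1111.2508 — 2 statements merged into one kernel-verified Lean document; each statement's English description precedes it below -/
import Mathlib

section
/- Let W be the loop polynomial with exponent matrix M, and let t ∈ ℤ^N be a vector with nonnegative entries. If the image of the monomial ∏_{i=1}^N X_i^{t_i} in the Milnor ring Q_W is a nonzero scalar multiple of the image of the Hessian determinant hess(W), then the rational vector (Mᵀ)⁻¹(t + 2·𝟙) has all entries in ℤ (where 𝟙 = (1, …, 1)ᵀ). -/
open MvPolynomial

/-- The loop polynomial `W = ∑ i, X i ^ a i * X (i+1)` (indices mod `N`). -/
noncomputable def loopW (N : ℕ) [NeZero N] (a : Fin N → ℕ) : MvPolynomial (Fin N) ℂ :=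
  ∑ i : Fin N, X i ^ a i * X (i + 1)

/-- The Jacobian ideal of `W`, generated by the partial derivatives. -/
noncomputable def jacIdeal {N : ℕ} (W : MvPolynomial (Fin N) ℂ) :
    Ideal (MvPolynomial (Fin N) ℂ) :=
  Ideal.span (Set.range fun i => pderiv i W)

/-- The Hessian determinant `hess W = det (∂²W/∂X i ∂X j)`. -/
noncomputable def hess {N : ℕ} (W : MvPolynomial (Fin N) ℂ) : MvPolynomial (Fin N) ℂ :=
  Matrix.det (Matrix.of fun i j => pderiv i (pderiv j W))

/-- The exponent matrix (over `ℚ`) of the loop polynomial with exponents `a`. -/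
def loopMatrixQ (N : ℕ) [NeZero N] (a : Fin N → ℕ) : Matrix (Fin N) (Fin N) ℚ :=
  Matrix.of fun i j => if j = i then (a i : ℚ) else if j = i + 1 then 1 else 0

lemma det_koszul_row {n R : Type*} [Fintype n] [DecidableEq n] [CommRing R]
    {A : Matrix n n R} {x : n → R} (hA : A.mulVec x = 0) (i p q : n) :
    x p * (A.updateRow i (Pi.single q 1)).det = x q * (A.updateRow i (Pi.single p 1)).det := by
  set P := A.updateRow i (Pi.single p 1) with hP
  have h1 : P.mulVec x = Pi.single i (x p) := by
    ext j
    by_cases hj : j = i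
    · subst hj
      simp [hP, Matrix.mulVec]
    · have := congrFun hA j
      simpa [hP, Matrix.mulVec, Matrix.updateRow_ne hj, hj] using this
  have h2 := congrFun (congrArg P.adjugate.mulVec h1) q
  rw [Matrix.mulVec_mulVec, Matrix.adjugate_mul, Matrix.smul_mulVec, Matrix.one_mulVec,
    Matrix.mulVec_single] at h2
  simp only [Pi.smul_apply, smul_eq_mul, Matrix.col_apply, Matrix.adjugate_apply,
    MulOpposite.smul_eq_mul_unop, MulOpposite.unop_op] at h2
  rw [hP, Matrix.updateRow_idem] at h2
  rw [hP, mul_comm (x q), h2, mul_comm]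

/-- Changing rows of a matrix killing `x` by multiples of Koszul syzygies of `x` does not change
the determinant. -/
lemma det_add_koszul {n R : Type*} [Fintype n] [DecidableEq n] [CommRing R]
    {A : Matrix n n R} {x : n → R} (hA : A.mulVec x = 0) (β : n → R) (p q : n → n) :
    (A + Matrix.of fun i => β i •
      (x (p i) • Pi.single (q i) (1 : R) - x (q i) • Pi.single (p i) (1 : R))).det = A.det := by
  set v : n → n → R := fun i => β i •
      (x (p i) • Pi.single (q i) (1 : R) - x (q i) • Pi.single (p i) (1 : R)) with hv
  have hvx (i : n) : v i ⬝ᵥ x = 0 := by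
    simp [hv, sub_dotProduct, mul_comm]
  suffices H : ∀ s : Finset n,
      (Matrix.of fun i => A i + if i ∈ s then v i else 0).det = A.det by
    have := H Finset.univ
    simp only [Finset.mem_univ, if_true] at this
    exact this
  intro s
  induction s using Finset.induction_on with
  | empty =>
    congr 1
    ext i j
    simp
  | insert i s hi ih =>
    set B : Matrix n n R := Matrix.of fun i => A i + if i ∈ s then v i else 0 with hB
    have hBx : B.mulVec x = 0 := by
      ext j
      have hj : A j ⬝ᵥ x = 0 := congrFun hA j
      have hB' : B j = A j + if j ∈ s then v j else 0 := rfl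
      rw [Matrix.mulVec, hB', add_dotProduct, hj]
      split_ifs <;> simp [hvx]
    have h1 : (Matrix.of fun j => A j + if j ∈ insert i s then v j else 0) =
        B.updateRow i (B i + v i) := by
      ext j k
      by_cases hj : j = i
      · subst hj
        simp [hB, hi]
      · simp [hB, hj]
    rw [h1, Matrix.det_updateRow_add, Matrix.updateRow_eq_self, ih]
    simp only [hv]
    rw [Matrix.det_updateRow_smul, sub_eq_add_neg, Matrix.det_updateRow_add, ← neg_smul,
      Matrix.det_updateRow_smul, Matrix.det_updateRow_smul, det_koszul_row hBx i (p i) (q i)]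
    ring

lemma fin_succ_ne {N : ℕ} [NeZero N] (hN : 2 ≤ N) (i : Fin N) : i + 1 ≠ i := by
  intro h
  have h1 : (1 : Fin N) = 0 := by simpa using h
  have := congrArg Fin.val h1
  rw [Fin.val_one', Fin.val_zero, Nat.mod_eq_of_lt (by omega)] at this
  omega

lemma pderiv_loopW {N : ℕ} [NeZero N] (a : Fin N → ℕ) (i : Fin N) :
    pderiv (i + 1) (loopW N a) =
      C (a (i + 1) : ℂ) * X (i + 1) ^ (a (i + 1) - 1) * X (i + 1 + 1) + X i ^ a i := by
  simp only [loopW, map_sum, Derivation.leibniz, Derivation.leibniz_pow, pderiv_X, smul_eq_mul,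
    nsmul_eq_mul, Finset.sum_add_distrib, Pi.single_apply, mul_ite, mul_one, mul_zero]
  simp only [add_left_inj, Finset.sum_ite_eq', Finset.mem_univ, if_true, eq_comm]
  simp
  ring

lemma pderiv_pderiv_loopW {N : ℕ} [NeZero N] (a : Fin N → ℕ) (i j : Fin N) :
    pderiv i (pderiv j (loopW N a)) =
      (if j = i then C ((a i : ℂ) * (a i - 1 : ℕ)) * X i ^ (a i - 2) * X (i + 1) else 0) +
      (if j = i + 1 then C (a i : ℂ) * X i ^ (a i - 1) else 0) +
      (if i = j + 1 then C (a j : ℂ) * X j ^ (a j - 1) else 0) := by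
  obtain ⟨l, rfl⟩ : ∃ l, j = l + 1 := ⟨j - 1, by simp⟩
  rw [pderiv_loopW]
  simp only [map_add, Derivation.leibniz, Derivation.leibniz_pow, pderiv_X, smul_eq_mul,
    nsmul_eq_mul, Pi.single_apply, mul_ite, mul_one, mul_zero, pderiv_C, add_zero]
  rw [add_assoc, add_comm (ite _ _ _)]
  congr 1
  · congr 1
    · by_cases h : l + 1 = i
      · subst h
        simp [Nat.sub_sub]
        ring
      · simp [h]
    · by_cases h : l = i
      · subst h
        simp
      · simp [h]
  · simp only [eq_comm]

lemma loopMatrixQ_mulVec {N : ℕ} [NeZero N] (hN : 2 ≤ N) (a : Fin N → ℕ) (w : Fin N → ℚ)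
    (i : Fin N) : (loopMatrixQ N a).mulVec w i = a i * w i + w (i + 1) := by
  have h : ∀ j, loopMatrixQ N a i j * w j =
      (if j = i then (a i : ℚ) * w i else 0) + if j = i + 1 then w (i + 1) else 0 := by
    intro j
    have := fin_succ_ne hN i
    by_cases h1 : j = i
    · subst h1
      simp [loopMatrixQ, this.symm]
    · by_cases h2 : j = i + 1
      · subst h2
        simp [loopMatrixQ, this]
      · simp [loopMatrixQ, h1, h2]
  simp [Matrix.mulVec, dotProduct, h, Finset.sum_add_distrib]

lemma loopMatrixQ_transpose_mulVec {N : ℕ} [NeZero N] (hN : 2 ≤ N) (a : Fin N → ℕ)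
    (k : Fin N → ℚ) (j : Fin N) :
    (loopMatrixQ N a).transpose.mulVec k (j + 1) = a (j + 1) * k (j + 1) + k j := by
  have h : ∀ i, (loopMatrixQ N a).transpose (j + 1) i * k i =
      (if i = j + 1 then (a (j + 1) : ℚ) * k (j + 1) else 0) + if i = j then k j else 0 := by
    intro i
    have := fin_succ_ne hN j
    by_cases h1 : i = j
    · subst h1
      simp [loopMatrixQ, this, this.symm]
    · by_cases h2 : i = j + 1
      · subst h2
        simp [loopMatrixQ, this]
      · simp [loopMatrixQ, h1, h2, Ne.symm h1, Ne.symm h2]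
  simp only [Matrix.mulVec, dotProduct, h]
  simp [Finset.sum_add_distrib]

lemma loopMatrixQ_det_ne_zero {N : ℕ} [NeZero N] (hN : 2 ≤ N) {a : Fin N → ℕ}
    (ha : ∀ i, 2 ≤ a i) : (loopMatrixQ N a).det ≠ 0 := by
  intro h
  obtain ⟨v, hv, hv0⟩ := Matrix.exists_mulVec_eq_zero_iff.mpr h
  obtain ⟨i, -, hi⟩ := Finset.exists_max_image Finset.univ (fun i => |v i|) Finset.univ_nonempty
  have h1 := congrFun hv0 i
  rw [loopMatrixQ_mulVec hN] at h1
  have h2 : (a i : ℚ) * |v i| = |v (i + 1)| := by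
    rw [← Nat.abs_cast (a i), ← abs_mul, ← abs_neg]
    congr 1
    simp only [Pi.zero_apply] at h1
    linarith
  have h3 := hi (i + 1) (Finset.mem_univ _)
  have h4 : (2 : ℚ) ≤ a i := by exact_mod_cast ha i
  have h5 : |v i| = 0 := by nlinarith [abs_nonneg (v i)]
  apply hv
  ext j
  have := hi j (Finset.mem_univ _)
  rw [h5] at this
  simpa using this

lemma exists_loop_weights {N : ℕ} [NeZero N] (hN : 2 ≤ N) {a : Fin N → ℕ}
    (ha : ∀ i, 2 ≤ a i) : ∃ w : Fin N → ℚ, (∀ i, a i * w i + w (i + 1) = 1) ∧ ∀ i, w i ≠ 1 := by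
  have hdet : IsUnit (loopMatrixQ N a).det := (loopMatrixQ_det_ne_zero hN ha).isUnit
  have ha' : ∀ i, (2 : ℚ) ≤ a i := fun i => by exact_mod_cast ha i
  set w : Fin N → ℚ := (loopMatrixQ N a)⁻¹.mulVec 1 with hw
  have h1 : ∀ i, a i * w i + w (i + 1) = 1 := by
    intro i
    rw [← loopMatrixQ_mulVec hN, hw, Matrix.mulVec_mulVec, Matrix.mul_nonsing_inv _ hdet]
    simp
  refine ⟨w, h1, fun i hi => ?_⟩
  obtain ⟨m, -, hm⟩ := Finset.exists_max_image Finset.univ (fun i => |w i|) Finset.univ_nonempty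
  have h2 : (a m : ℚ) * |w m| ≤ 1 + |w (m + 1)| := by
    rw [← Nat.abs_cast (a m), ← abs_mul, show (a m : ℚ) * w m = 1 - w (m + 1) by linarith [h1 m]]
    simpa using abs_sub (1 : ℚ) (w (m + 1))
  have h3 := hm (m + 1) (Finset.mem_univ _)
  have h4 : |w m| ≤ 1 := by nlinarith [abs_nonneg (w m), ha' m]
  have h5 := (abs_le.mp ((hm (i + 1 + 1) (Finset.mem_univ _)).trans h4)).2
  have h6 := h1 i
  have h7 := h1 (i + 1)
  rw [hi] at h6
  nlinarith [ha' i, ha' (i + 1)]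

/-- The cyclic bidiagonal matrix expressing the partial derivatives of `W` in the variables. -/
noncomputable def loopBidiag (N : ℕ) [NeZero N] (a : Fin N → ℕ) :
    Matrix (Fin N) (Fin N) (MvPolynomial (Fin N) ℂ) :=
  Matrix.of fun i j => (if j = i then C (a i : ℂ) * X i ^ (a i - 2) * X (i + 1) else 0) +
    if i = j + 1 then X j ^ (a j - 1) else 0

lemma loopBidiag_det {N : ℕ} [NeZero N] (hN : 2 ≤ N) {a : Fin N → ℕ} (ha : ∀ i, 2 ≤ a i) :
    (loopBidiag N a).det = C ((loopMatrixQ N a).det : ℂ) * ∏ i, X i ^ (a i - 1) := by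
  have hX : (∏ i : Fin N, X i : MvPolynomial (Fin N) ℂ) ≠ 0 :=
    Finset.prod_ne_zero_iff.mpr fun i _ => X_ne_zero i
  apply mul_left_cancel₀ hX
  set φ : ℚ →+* MvPolynomial (Fin N) ℂ := C.comp (Rat.castHom ℂ) with hφ
  have hφdet : C ((loopMatrixQ N a).det : ℂ) = (φ.mapMatrix (loopMatrixQ N a).transpose).det := by
    rw [← RingHom.map_det, Matrix.det_transpose]
    simp [hφ]
  have hshift : ∏ i : Fin N, (X (i + 1) : MvPolynomial (Fin N) ℂ) = ∏ i : Fin N, X i :=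
    Equiv.prod_comp (Equiv.addRight (1 : Fin N)) fun i => (X i : MvPolynomial (Fin N) ℂ)
  rw [hφdet, ← Matrix.det_mul_column, mul_left_comm, mul_comm (∏ i, X i) (∏ i, X i ^ _), ← hshift,
    ← Finset.prod_mul_distrib, mul_comm, ← Matrix.det_mul_row]
  congr 1
  ext1 i j
  have hs := fin_succ_ne hN j
  have hj : (X j : MvPolynomial (Fin N) ℂ) ^ (a j - 1) = X j ^ (a j - 2) * X j := by
    rw [← pow_succ]
    congr 1
    have := ha j
    omega
  by_cases h1 : i = j
  · subst h1
    simp [loopBidiag, loopMatrixQ, hφ, hs.symm, hj]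
    ring
  · by_cases h2 : i = j + 1
    · subst h2
      simp [loopBidiag, loopMatrixQ, hφ, hs, hs.symm]
      ring
    · simp [loopBidiag, loopMatrixQ, hφ, h1, h2, Ne.symm h1]

lemma loopBidiag_mulVec_X {N : ℕ} [NeZero N] {a : Fin N → ℕ} (ha : ∀ i, 2 ≤ a i) :
    (loopBidiag N a).mulVec X = fun i => pderiv i (loopW N a) := by
  ext1 i
  obtain ⟨l, rfl⟩ : ∃ l, i = l + 1 := ⟨i - 1, by simp⟩
  have h1 := ha (l + 1)
  have h2 := ha l
  rw [pderiv_loopW, show a (l + 1) - 1 = a (l + 1) - 2 + 1 by omega]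
  rw [← pow_sub_one_mul (show a l ≠ 0 by omega) (X l)]
  simp only [Matrix.mulVec, dotProduct, loopBidiag, Matrix.of_apply, add_mul, ite_mul, zero_mul,
    Finset.sum_add_distrib, Finset.sum_ite_eq', Finset.mem_univ, if_true, add_left_inj,
    Finset.sum_ite_eq]
  ring

lemma hess_sub_mem_jacIdeal {N : ℕ} [NeZero N] (hN : 2 ≤ N) {a : Fin N → ℕ}
    (ha : ∀ i, 2 ≤ a i) : ∃ c d : ℂ, d ≠ 0 ∧
      C c * hess (loopW N a) - C d * ∏ i, X i ^ (a i - 1) ∈ jacIdeal (loopW N a) := by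
  obtain ⟨w, hw, hw1⟩ := exists_loop_weights hN ha
  set φ := Ideal.Quotient.mk (jacIdeal (loopW N a)) with hφ
  set E : Matrix (Fin N) (Fin N) (MvPolynomial (Fin N) ℂ) :=
    Matrix.of fun i j => C (1 - w i : ℂ) * loopBidiag N a i j with hE
  set H : Matrix (Fin N) (Fin N) (MvPolynomial (Fin N) ℂ) :=
    Matrix.of fun i j => C (w j : ℂ) * pderiv i (pderiv j (loopW N a)) with hH
  refine ⟨∏ i, (w i : ℂ), (∏ i, (1 - w i : ℂ)) * ((loopMatrixQ N a).det : ℂ), ?_, ?_⟩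
  · refine mul_ne_zero (Finset.prod_ne_zero_iff.mpr fun i _ => sub_ne_zero.mpr ?_) ?_
    · exact_mod_cast (hw1 i).symm
    · exact_mod_cast loopMatrixQ_det_ne_zero hN ha
  · have hEdet : E.det = C ((∏ i, (1 - w i : ℂ)) * ((loopMatrixQ N a).det : ℂ)) *
        ∏ i, X i ^ (a i - 1) := by
      rw [hE, Matrix.det_mul_column, loopBidiag_det hN ha, map_mul, map_prod, mul_assoc]
    have hHdet : H.det = C (∏ i, (w i : ℂ)) * hess (loopW N a) := by
      rw [map_prod, hess, ← Matrix.det_mul_row]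
      rfl
    have hEX : (φ.mapMatrix E).mulVec (fun i => φ (X i)) = 0 := by
      ext1 i
      have h1 : E.mulVec X i = C (1 - w i : ℂ) * pderiv i (loopW N a) := by
        rw [← congrFun (loopBidiag_mulVec_X ha) i]
        simp [hE, Matrix.mulVec, dotProduct, Finset.mul_sum, mul_assoc]
      have h2 : (φ.mapMatrix E).mulVec (fun i => φ (X i)) i = φ (E.mulVec X i) := by
        simp [Matrix.mulVec, dotProduct]
      rw [h2, h1, Pi.zero_apply, hφ, Ideal.Quotient.eq_zero_iff_mem]
      exact Ideal.mul_mem_left _ _ (Ideal.subset_span ⟨i, rfl⟩)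
    have key := det_add_koszul hEX
      (fun i => φ (C (a i * w (i + 1) : ℂ) * X i ^ (a i - 2))) id (fun i => i + 1)
    rw [← hEdet, ← hHdet, ← Ideal.Quotient.eq, RingHom.map_det, RingHom.map_det, ← hφ, ← key]
    congr 1
    ext1 i j
    have hs := fin_succ_ne hN i
    have h1 : (X i : MvPolynomial (Fin N) ℂ) ^ (a i - 1) = X i ^ (a i - 2) * X i := by
      rw [← pow_succ]
      congr 1
      have := ha i
      omega
    have hcast : ((a i - 1 : ℕ) : ℂ) = (a i : ℂ) - 1 := by
      have := ha i
      push_cast [show 1 ≤ a i by omega]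
      ring
    have hwC (i) : (a i : ℂ) * w i + w (i + 1) = 1 := by exact_mod_cast hw i
    have hprev : i = j + 1 → C (w j : ℂ) * (C (a j : ℂ) * X j ^ (a j - 1)) =
        C (1 - w i : ℂ) * (X j : MvPolynomial (Fin N) ℂ) ^ (a j - 1) := by
      rintro rfl
      rw [← mul_assoc, ← C_mul, show (w j : ℂ) * a j = 1 - w (j + 1) by linear_combination hwC j]
    have hpoly : H i j = E i j + C (a i * w (i + 1) : ℂ) * X i ^ (a i - 2) *
        (X i * Pi.single (M := fun _ => MvPolynomial (Fin N) ℂ) (i + 1) 1 j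
          - X (i + 1) * Pi.single (M := fun _ => MvPolynomial (Fin N) ℂ) i 1 j) := by
      simp only [hH, hE, Matrix.of_apply, pderiv_pderiv_loopW, loopBidiag, mul_add]
      rw [show (C (w j : ℂ) * if i = j + 1 then C (a j : ℂ) * X j ^ (a j - 1) else 0) =
        (C (1 - w i : ℂ) * if i = j + 1 then (X j : MvPolynomial (Fin N) ℂ) ^ (a j - 1) else 0) by
          split_ifs with h
          · exact hprev h
          · simp]
      by_cases h2 : j = i
      · subst h2
        have : (w j : ℂ) * (a j * (a j - 1 : ℕ)) = (1 - w j) * a j - a j * w (j + 1) := by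
          rw [hcast]
          linear_combination (a j : ℂ) * hwC j
        have := congrArg (C (σ := Fin N)) this
        simp only [hs.symm, if_true, if_false, Pi.single_eq_same, Pi.single_eq_of_ne hs.symm,
          map_mul, map_sub, map_one] at this ⊢
        linear_combination (X j ^ (a j - 2) * X (j + 1)) * this
      · by_cases h3 : j = i + 1
        · subst h3
          simp only [hs, if_true, if_false, Pi.single_eq_same, Pi.single_eq_of_ne hs, h1, map_mul]
          ring
        · simp [h2, h3]
    have := congrArg φ hpoly
    simp only [RingHom.mapMatrix_apply, Matrix.map_apply, Matrix.add_apply, Matrix.of_apply, this,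
      map_add, map_mul, map_sub, Pi.smul_apply, Pi.sub_apply, smul_eq_mul, id]
    simp [Pi.single_apply]

lemma loop_exponent_rigidity {N : ℕ} [NeZero N] {a : Fin N → ℕ}
    (ha : ∀ i, 2 ≤ a i) (q : Fin N → ℤ) (hq : ∑ j, q j = N - 1) (i : Fin N)
    (h : ∀ j, j ≠ i → 2 ≤ a (j + 1) * q (j + 1) + q j)
    (hi : 1 ≤ a (i + 1) * q (i + 1) + q i) : q (i + 1) = 0 ∧ 1 ≤ q i := by
  have ha' : ∀ j, (2 : ℤ) ≤ a j := fun j => by exact_mod_cast ha j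
  set p : Fin N → ℤ := fun j => max 0 (q j - 1) with hp
  set d : Fin N → ℤ := fun j => max 0 (1 - q j) with hd
  have hpd : ∀ j, q j - 1 = p j - d j := fun j => by simp only [hp, hd]; omega
  have hshift : ∑ j, d (j + 1) = ∑ j, d j := Equiv.sum_comp (Equiv.addRight (1 : Fin N)) d
  have hsum : ∑ j, (p j - d (j + 1)) = -1 := by
    rw [Finset.sum_sub_distrib, hshift, ← Finset.sum_sub_distrib, ← Finset.sum_congr rfl
      fun j _ => hpd j, Finset.sum_sub_distrib, hq]
    simp
  have hne : ∀ j, j ≠ i → 0 ≤ p j - d (j + 1) := by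
    intro j hj
    have h1 := h j hj
    have h2 := ha' (j + 1)
    simp only [hp, hd]
    by_cases h3 : 1 ≤ q (j + 1)
    · omega
    · have : (a (j + 1) : ℤ) * q (j + 1) ≤ 2 * q (j + 1) := by nlinarith
      omega
  have hle : p i - d (i + 1) ≤ -1 := by
    rw [← hsum, ← Finset.add_sum_erase _ _ (Finset.mem_univ i)]
    have := Finset.sum_nonneg (s := Finset.univ.erase i) (f := fun j => p j - d (j + 1))
      fun j hj => hne j (Finset.ne_of_mem_erase hj)
    linarith
  simp only [hp, hd] at hle
  by_cases h3 : 1 ≤ q (i + 1)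
  · omega
  · have : (a (i + 1) : ℤ) * q (i + 1) ≤ 2 * q (i + 1) := by nlinarith [ha' (i + 1)]
    have h0 : q (i + 1) = 0 := by omega
    rw [h0] at hi
    exact ⟨h0, by linarith⟩

open Classical in
/-- The residue of the monomial with exponent vector `s`, as a function of
`y = (Mᵀ)⁻¹ (s + 2·𝟙)` and up to a global scalar. -/
noncomputable def loopWeight (N : ℕ) (a : Fin N → ℕ) (y : Fin N → ℚ) : ℂ :=
  if (∃ k : Fin N → ℤ, y = fun i => (k i : ℚ)) ∧ ∑ i, y i = N then
    ∏ i, if y i = 0 then -(a i : ℂ) else 1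
  else 0

/-- The vector `(Mᵀ)⁻¹ (s + 2·𝟙)`. -/
noncomputable def loopCharge (N : ℕ) [NeZero N] (a : Fin N → ℕ) (s : Fin N → ℕ) : Fin N → ℚ :=
  (loopMatrixQ N a).transpose⁻¹.mulVec fun j => (s j : ℚ) + 2

lemma loopCharge_eq {N : ℕ} [NeZero N] (hN : 2 ≤ N) {a : Fin N → ℕ} (ha : ∀ i, 2 ≤ a i)
    {s : Fin N → ℕ} {y : Fin N → ℚ}
    (h : ∀ j, (s (j + 1) : ℚ) + 2 = a (j + 1) * y (j + 1) + y j) : loopCharge N a s = y := by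
  have hdet : IsUnit (loopMatrixQ N a).transpose.det := by
    rw [Matrix.det_transpose]
    exact (loopMatrixQ_det_ne_zero hN ha).isUnit
  have : (fun j => (s j : ℚ) + 2) = (loopMatrixQ N a).transpose.mulVec y := by
    ext i
    obtain ⟨l, rfl⟩ : ∃ l, i = l + 1 := ⟨i - 1, by simp⟩
    rw [h, loopMatrixQ_transpose_mulVec hN]
  rw [loopCharge, this, Matrix.mulVec_mulVec, Matrix.nonsing_inv_mul _ hdet, Matrix.one_mulVec]

/-- A multiple of the residue pairing of `W`, as a linear functional on polynomials. -/
noncomputable def loopResidue (N : ℕ) [NeZero N] (a : Fin N → ℕ) :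
    MvPolynomial (Fin N) ℂ →ₗ[ℂ] ℂ :=
  (basisMonomials (Fin N) ℂ).constr ℂ fun s => loopWeight N a (loopCharge N a s)

lemma loopResidue_monomial {N : ℕ} [NeZero N] (a : Fin N → ℕ) (s : Fin N →₀ ℕ) :
    loopResidue N a (monomial s 1) = loopWeight N a (loopCharge N a s) := by
  have h := (basisMonomials (Fin N) ℂ).constr_basis ℂ
    (fun s => loopWeight N a (loopCharge N a s)) s
  rwa [coe_basisMonomials] at h

lemma loopWeight_relation {N : ℕ} [NeZero N] (hN : 2 ≤ N) {a : Fin N → ℕ}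
    (ha : ∀ i, 2 ≤ a i) (u : Fin N → ℕ) (i : Fin N) (y : Fin N → ℚ)
    (hy : ∀ j, a (j + 1) * y (j + 1) + y j = u (j + 1) + 2 - if j = i then 1 else 0) :
    a (i + 1) * loopWeight N a (y + Pi.single (i + 1) 1) +
      loopWeight N a (y + Pi.single i 1) = 0 := by
  classical
  have hs := fin_succ_ne hN i
  have hint (l : Fin N) : (∃ k : Fin N → ℤ, y + Pi.single l 1 = fun i => (k i : ℚ)) ↔
      ∃ k : Fin N → ℤ, y = fun i => (k i : ℚ) := by
    constructor
    · rintro ⟨k, hk⟩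
      refine ⟨k - Pi.single l 1, ?_⟩
      rw [← eq_sub_iff_add_eq] at hk
      rw [hk]
      ext j
      by_cases hj : j = l <;> simp [hj]
    · rintro ⟨k, rfl⟩
      refine ⟨k + Pi.single l 1, ?_⟩
      ext j
      by_cases hj : j = l <;> simp [hj]
  have hsum (l : Fin N) : (∑ j, (y + Pi.single l 1 : Fin N → ℚ) j = N) ↔ ∑ j, y j = N - 1 := by
    simp [Finset.sum_add_distrib, eq_sub_iff_add_eq]
  simp only [loopWeight, hint, hsum]
  split_ifs with hc
  swap
  · simp
  obtain ⟨⟨q, rfl⟩, hq⟩ := hc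
  beta_reduce at hq hy
  have hq' : ∑ j, q j = (N : ℤ) - 1 := by
    rw [eq_sub_iff_add_eq] at hq ⊢
    exact_mod_cast hq
  obtain ⟨h0, h1⟩ := loop_exponent_rigidity ha q hq' i
    (fun j hj => by
      have := hy j
      rw [if_neg hj, sub_zero] at this
      have h2 : (a (j + 1) : ℤ) * q (j + 1) + q j = u (j + 1) + 2 := by exact_mod_cast this
      omega)
    (by
      have := hy i
      rw [if_pos rfl] at this
      rw [eq_sub_iff_add_eq] at this
      have h2 : (a (i + 1) : ℤ) * q (i + 1) + q i + 1 = u (i + 1) + 2 := by exact_mod_cast this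
      omega)
  have h1' : (1 : ℚ) ≤ q i := by exact_mod_cast h1
  rw [← Finset.mul_prod_erase Finset.univ _ (Finset.mem_univ (i + 1)),
    ← Finset.mul_prod_erase Finset.univ _ (Finset.mem_univ (i + 1))]
  have hprod : ∏ x ∈ Finset.univ.erase (i + 1),
        (if ((fun j => (q j : ℚ)) + Pi.single (i + 1) 1 : Fin N → ℚ) x = 0 then -(a x : ℂ) else 1) =
      ∏ x ∈ Finset.univ.erase (i + 1),
        (if ((fun j => (q j : ℚ)) + Pi.single i 1 : Fin N → ℚ) x = 0 then -(a x : ℂ) else 1) := by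
    refine Finset.prod_congr rfl fun x hx => ?_
    have hx' := Finset.ne_of_mem_erase hx
    by_cases hxi : x = i
    · subst hxi
      have h2 : (q x : ℚ) ≠ 0 := by linarith
      have h3 : (q x : ℚ) + 1 ≠ 0 := by linarith
      simp only [Pi.add_apply, Pi.single_eq_of_ne hx', Pi.single_eq_same, add_zero, h2, h3,
        if_false]
    · simp only [Pi.add_apply, Pi.single_eq_of_ne hx', Pi.single_eq_of_ne hxi]
  rw [hprod]
  simp [h0, Pi.single_eq_of_ne hs]

lemma loopResidue_mul_pderiv {N : ℕ} [NeZero N] (hN : 2 ≤ N) {a : Fin N → ℕ}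
    (ha : ∀ i, 2 ≤ a i) (f : MvPolynomial (Fin N) ℂ) (i : Fin N) :
    loopResidue N a (f * pderiv i (loopW N a)) = 0 := by
  obtain ⟨l, rfl⟩ : ∃ l, i = l + 1 := ⟨i - 1, by simp⟩
  suffices H : (loopResidue N a).comp (LinearMap.mulRight ℂ (pderiv (l + 1) (loopW N a))) = 0 from
    LinearMap.congr_fun H f
  refine (basisMonomials (Fin N) ℂ).ext fun u => ?_
  have hs := fin_succ_ne hN
  set A : Fin N →₀ ℕ := u + Finsupp.single (l + 1) (a (l + 1) - 1) + Finsupp.single (l + 1 + 1) 1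
    with hA
  set B : Fin N →₀ ℕ := u + Finsupp.single l (a l) with hB
  have h1 : monomial u (1 : ℂ) * pderiv (l + 1) (loopW N a) =
      (a (l + 1) : ℂ) • monomial A 1 + monomial B 1 := by
    rw [pderiv_loopW, X_pow_eq_monomial, X_pow_eq_monomial, X, mul_add, mul_assoc,
      mul_left_comm, monomial_mul, monomial_mul, monomial_mul, ← add_assoc, smul_eq_C_mul]
    simp [hA, hB]
  obtain ⟨y, hy⟩ : ∃ y : Fin N → ℚ, ∀ j,
      a (j + 1) * y (j + 1) + y j = u (j + 1) + 2 - if j = l then 1 else 0 := by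
    refine ⟨(loopMatrixQ N a).transpose⁻¹.mulVec
      fun j => (u j : ℚ) + 2 - if j = l + 1 then 1 else 0, fun j => ?_⟩
    have hdet : IsUnit (loopMatrixQ N a).transpose.det := by
      rw [Matrix.det_transpose]
      exact (loopMatrixQ_det_ne_zero hN ha).isUnit
    rw [← loopMatrixQ_transpose_mulVec hN, Matrix.mulVec_mulVec, Matrix.mul_nonsing_inv _ hdet,
      Matrix.one_mulVec]
    simp
  have hcA : loopCharge N a A = y + Pi.single (l + 1) 1 := by
    refine loopCharge_eq hN ha fun j => ?_
    have hyj := hy j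
    have h2 : ((a (l + 1) - 1 : ℕ) : ℚ) = (a (l + 1) : ℚ) - 1 := by
      have := ha (l + 1)
      push_cast [show 1 ≤ a (l + 1) by omega]
      ring
    by_cases hj : j = l
    · subst hj
      simp only [if_true] at hyj
      simp [hA, h2, (hs _).symm]
      linarith
    · by_cases hj' : j = l + 1
      · subst hj'
        simp only [hj, if_false] at hyj
        simp [hA, hs]
        linarith
      · simp only [hj, if_false] at hyj
        simp [hA, hj, hj']
        linarith
  have hcB : loopCharge N a B = y + Pi.single l 1 := by
    refine loopCharge_eq hN ha fun j => ?_
    have hyj := hy j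
    by_cases hj : j = l
    · subst hj
      simp only [if_true] at hyj
      simp [hB, hs]
      linarith
    · simp only [hj, if_false] at hyj
      by_cases hj' : l = j + 1
      · subst hj'
        simp [hB, (hs _).symm]
        linarith
      · simp [hB, hj, Ne.symm hj']
        linarith
  rw [LinearMap.comp_apply, LinearMap.mulRight_apply, coe_basisMonomials, h1, map_add, map_smul,
    loopResidue_monomial, loopResidue_monomial, hcA, hcB, smul_eq_mul,
    loopWeight_relation hN ha u l y hy, LinearMap.zero_apply]

lemma loopResidue_eq_zero_of_mem {N : ℕ} [NeZero N] (hN : 2 ≤ N) {a : Fin N → ℕ}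
    (ha : ∀ i, 2 ≤ a i) {f : MvPolynomial (Fin N) ℂ} (hf : f ∈ jacIdeal (loopW N a)) :
    loopResidue N a f = 0 := by
  obtain ⟨c, rfl⟩ := Ideal.mem_span_range_iff_exists_fun.mp hf
  rw [map_sum]
  exact Finset.sum_eq_zero fun i _ => loopResidue_mul_pderiv hN ha (c i) i

lemma loopResidue_prod_X_pow {N : ℕ} [NeZero N] (a s : Fin N → ℕ) :
    loopResidue N a (∏ i, X i ^ s i) = loopWeight N a (loopCharge N a s) := by
  rw [prod_X_pow, loopResidue_monomial]
  congr 2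
  ext j
  simp

lemma loopResidue_socle {N : ℕ} [NeZero N] (hN : 2 ≤ N) {a : Fin N → ℕ}
    (ha : ∀ i, 2 ≤ a i) : loopResidue N a (∏ i, X i ^ (a i - 1)) = 1 := by
  have h : loopCharge N a (fun i => a i - 1) = 1 := by
    refine loopCharge_eq hN ha fun j => ?_
    have := ha (j + 1)
    push_cast [show 1 ≤ a (j + 1) by omega]
    simp
    ring
  rw [loopResidue_prod_X_pow a fun i => a i - 1, h, loopWeight, if_pos]
  · simp
  · exact ⟨⟨1, by ext; simp⟩, by simp⟩

/-- If the image in the Milnor ring of the monomial `∏ X i ^ t i` (with nonnegative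
integer exponents `t`) is a nonzero scalar multiple of the image of the Hessian
determinant, then `(Mᵀ)⁻¹ (t + 2·𝟙)` is an integer vector. -/
theorem loop_hess_integrality (N : ℕ) [NeZero N] (hN : 2 ≤ N) (a : Fin N → ℕ)
    (ha : ∀ i, 2 ≤ a i) (t : Fin N → ℕ)
    (h : ∃ c : ℂ, c ≠ 0 ∧
      Ideal.Quotient.mk (jacIdeal (loopW N a)) (∏ i : Fin N, X i ^ t i) =
        c • Ideal.Quotient.mk (jacIdeal (loopW N a)) (hess (loopW N a))) :
    ∀ i : Fin N, ∃ z : ℤ,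
      ((loopMatrixQ N a).transpose⁻¹.mulVec (fun j => (t j : ℚ) + 2)) i = z := by
  obtain ⟨e, he, hmem⟩ := h
  obtain ⟨c, d, hd, hcd⟩ := hess_sub_mem_jacIdeal hN ha
  have h1 : ∏ i, X i ^ t i - C e * hess (loopW N a) ∈ jacIdeal (loopW N a) := by
    rw [← Ideal.Quotient.eq, hmem, ← smul_eq_C_mul]
    rfl
  have h2 := loopResidue_eq_zero_of_mem hN ha h1
  have h3 := loopResidue_eq_zero_of_mem hN ha hcd
  simp only [← smul_eq_C_mul, map_sub, map_smul, smul_eq_mul, loopResidue_socle hN ha,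
    mul_one] at h2 h3
  have h4 : loopWeight N a (loopCharge N a t) ≠ 0 := by
    rw [← loopResidue_prod_X_pow]
    intro h0
    rw [h0, zero_sub, neg_eq_zero, mul_eq_zero, or_iff_right he] at h2
    rw [h2, mul_zero, zero_sub, neg_eq_zero] at h3
    exact hd h3
  intro i
  obtain ⟨⟨k, hk⟩, -⟩ : (∃ k : Fin N → ℤ, loopCharge N a t = fun i => (k i : ℚ)) ∧
      ∑ i, loopCharge N a t i = N := by
    by_contra hc
    exact h4 (if_neg hc)
  exact ⟨k i, congrFun hk i⟩
end

section
/- Let W be the loop polynomial with exponent matrix M. Suppose r, s ∈ ℤ^N satisfy 0 ≤ r_i ≤ a_i − 1 and 0 ≤ s_i ≤ a_i − 1 for all i. Then the following are equivalent: (1) the rational vector (Mᵀ)⁻¹(r + s + 2·𝟙) has all entries in ℤ (where 𝟙 = (1, …, 1)ᵀ); (2) the image of the monomial ∏_{i=1}^N X_i^{r_i + s_i} in the Milnor ring Q_W is a nonzero scalar multiple of the image of the Hessian determinant hess(W). -/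
open MvPolynomial

namespace LoopPoly

section CyclicFin

variable {N : ℕ} [NeZero N]

theorem fin_add_one_ne (hN : 2 ≤ N) (i : Fin N) : i + 1 ≠ i := by
  intro h
  have h1 : (1 : Fin N) = 0 := by simpa using h
  have h2 := congrArg Fin.val h1
  rw [Fin.val_one', Fin.val_zero, Nat.mod_eq_of_lt (by omega)] at h2
  omega

theorem fin_add_one_add_one_ne (hN : 3 ≤ N) (i : Fin N) : i + 1 + 1 ≠ i := by
  intro h
  have h1 : (1 : Fin N) + 1 = 0 := by simpa [add_assoc] using h
  have h2 := congrArg Fin.val h1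
  rw [Fin.val_add, Fin.val_one', Fin.val_zero, Nat.mod_eq_of_lt (a := 1) (by omega),
    Nat.mod_eq_of_lt (by omega)] at h2
  omega

theorem fin_val_nsmul_one (i : Fin N) : i.val • (1 : Fin N) = i := by
  have h : ∀ n : ℕ, ((n • (1 : Fin N) : Fin N)).val = n % N := by
    intro n
    induction n with
    | zero => simp
    | succ n ih => rw [succ_nsmul, Fin.val_add, ih, Fin.val_one', Nat.add_mod_mod, Nat.mod_add_mod]
  apply Fin.ext
  rw [h, Nat.mod_eq_of_lt i.isLt]

theorem fin_cyclic_induction {p : Fin N → Prop} {i : Fin N} (hi : p i)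
    (step : ∀ j, p j → p (j + 1)) (j : Fin N) : p j := by
  have h : ∀ n : ℕ, p (i + n • (1 : Fin N)) := by
    intro n
    induction n with
    | zero => simpa using hi
    | succ n ih => rw [succ_nsmul, ← add_assoc]; exact step _ ih
  have := h (j - i).val
  rwa [fin_val_nsmul_one, add_sub_cancel] at this

theorem fin_cyclic_induction_down {p : Fin N → Prop} {i : Fin N} (hi : p i)
    (step : ∀ j, p (j + 1) → p j) (j : Fin N) : p j := by
  have h : ∀ n : ℕ, p (i - n • (1 : Fin N)) := by
    intro n
    induction n with
    | zero => simpa using hi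
    | succ n ih =>
      apply step
      rwa [succ_nsmul, ← sub_sub, sub_add_cancel]
  have := h (i - j).val
  rwa [fin_val_nsmul_one, sub_sub_cancel] at this

end CyclicFin

section Independent

variable {N : ℕ} [NeZero N]

/-- No two cyclically adjacent elements. -/
def Indep (T : Finset (Fin N)) : Prop := ∀ j ∈ T, j + 1 ∉ T

/-- The exponent vector obtained from `∏ X i ^ (a i - 1)` by trading, for each `i ∈ T`, the factor
`X i ^ (a i - 1) * X (i + 1)` for `X (i - 1) ^ a (i - 1)`. -/
def expZ (a : Fin N → ℕ) (T : Finset (Fin N)) (j : Fin N) : ℤ :=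
  a j - 1 - (if j ∈ T then (a j : ℤ) - 1 else 0) + (if j + 1 ∈ T then (a j : ℤ) else 0)
    - (if j - 1 ∈ T then 1 else 0)

/-- `expZ` as a vector of natural numbers (meaningful for independent `T`). -/
noncomputable def expo (a : Fin N → ℕ) (T : Finset (Fin N)) : Fin N →₀ ℕ :=
  Finsupp.equivFunOnFinite.symm fun j => (expZ a T j).toNat

variable {a : Fin N → ℕ} {T : Finset (Fin N)}

theorem Indep.subset {S : Finset (Fin N)} (hT : Indep T) (h : S ⊆ T) : Indep S :=
  fun j hj hj' => hT j (h hj) (h hj')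

theorem Indep.sub_one_notMem (hT : Indep T) {j : Fin N} (hj : j ∈ T) : j - 1 ∉ T :=
  fun h => hT _ h (by rwa [sub_add_cancel])

theorem Indep.expZ_eq_zero (hT : Indep T) {j : Fin N} (hj : j ∈ T) : expZ a T j = 0 := by
  simp [expZ, hj, hT j hj, hT.sub_one_notMem hj]

theorem Indep.expo_apply (ha : ∀ i, 2 ≤ a i) (hT : Indep T) (j : Fin N) :
    (expo a T j : ℤ) = expZ a T j := by
  have h0 : 0 ≤ expZ a T j := by
    by_cases hj : j ∈ T
    · exact (hT.expZ_eq_zero hj).ge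
    · have := ha j
      simp only [expZ, hj, if_false]
      split_ifs <;> omega
  simpa [expo] using h0

theorem Indep.expo_eq_iff (ha : ∀ i, 2 ≤ a i) (hT : Indep T) (m : Fin N →₀ ℕ) :
    expo a T = m ↔ ∀ j, expZ a T j = m j := by
  simp only [Finsupp.ext_iff, ← hT.expo_apply ha, Nat.cast_inj]

theorem expZ_insert {i : Fin N} (hi : i ∉ T) (j : Fin N) :
    expZ a (insert i T) j = expZ a T j - (if j = i then (a j : ℤ) - 1 else 0)
      + (if j + 1 = i then (a j : ℤ) else 0) - (if j - 1 = i then 1 else 0) := by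
  have e1 : ∀ x : Fin N, ∀ c : ℤ, (if x ∈ insert i T then c else 0) =
      (if x ∈ T then c else 0) + (if x = i then c else 0) := by
    intro x c
    by_cases h : x = i
    · subst h; simp [hi]
    · simp [h]
  simp only [expZ, e1]
  ring

/-- The exponent of the first monomial of `X ^ m * ∂ W / ∂ X i`. -/
noncomputable def expFst (a : Fin N → ℕ) (m : Fin N →₀ ℕ) (i : Fin N) : Fin N →₀ ℕ :=
  m + (Finsupp.single i (a i - 1) + Finsupp.single (i + 1) 1)

/-- The exponent of the second monomial of `X ^ m * ∂ W / ∂ X i`. -/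
noncomputable def expSnd (a : Fin N → ℕ) (m : Fin N →₀ ℕ) (i : Fin N) : Fin N →₀ ℕ :=
  m + Finsupp.single (i - 1) (a (i - 1))

theorem expFst_apply (ha : ∀ i, 2 ≤ a i) (m : Fin N →₀ ℕ) (i j : Fin N) :
    (expFst a m i j : ℤ) = m j + (if j = i then (a j : ℤ) - 1 else 0) +
      (if j - 1 = i then 1 else 0) := by
  have := ha i
  by_cases h : j = i
  · subst h
    simp only [expFst, Finsupp.add_apply, Finsupp.single_apply, sub_eq_iff_eq_add,
      eq_comm (a := j + 1)]
    split_ifs <;> grind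
  · simp only [expFst, Finsupp.add_apply, Finsupp.single_apply, sub_eq_iff_eq_add,
      eq_comm (a := i + 1), eq_comm (a := i)]
    split_ifs <;> grind

theorem expSnd_apply (m : Fin N →₀ ℕ) (i j : Fin N) :
    (expSnd a m i j : ℤ) = m j + (if j + 1 = i then (a j : ℤ) else 0) := by
  simp only [expSnd, Finsupp.add_apply, Finsupp.single_apply, sub_eq_iff_eq_add,
    eq_comm (a := i)]
  split_ifs with h
  · subst h; simp
  · simp

theorem Indep.expo_ne_expFst (ha : ∀ i, 2 ≤ a i) (hT : Indep T) {i : Fin N} (hi : i ∈ T)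
    (m : Fin N →₀ ℕ) : expo a T ≠ expFst a m i := by
  intro h
  have h1 := (hT.expo_eq_iff ha _).1 h i
  rw [hT.expZ_eq_zero hi, expFst_apply ha] at h1
  have := ha i
  simp only [if_true] at h1
  split_ifs at h1 <;> omega

theorem Indep.expo_ne_expSnd (ha : ∀ i, 2 ≤ a i) (hT : Indep T) {i : Fin N} (hi : i ∉ T)
    (m : Fin N →₀ ℕ) : expo a T ≠ expSnd a m i := by
  intro h
  have h1 := (hT.expo_eq_iff ha _).1 h (i - 1)
  have := ha (i - 1)
  simp only [expSnd_apply, expZ, sub_add_cancel, hi, if_true, if_false] at h1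
  split_ifs at h1 <;> omega

theorem Indep.insert (hN : 2 ≤ N) {i : Fin N} (hT : Indep T) (h1 : i + 1 ∉ T)
    (h2 : i - 1 ∉ T) : Indep (insert i T) := by
  intro j hj hj'
  rw [Finset.mem_insert] at hj hj'
  have := fin_add_one_ne hN i
  rcases hj with rfl | hj
  · tauto
  · rcases hj' with h | hj'
    · rw [← h, add_sub_cancel_right] at h2
      exact h2 hj
    · exact hT j hj hj'

theorem expo_insert_iff (hN : 2 ≤ N) (ha : ∀ i, 2 ≤ a i) {i : Fin N} (hi : i ∉ T)
    (m : Fin N →₀ ℕ) :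
    (Indep T ∧ expo a T = expFst a m i) ↔
      (Indep (insert i T) ∧ expo a (insert i T) = expSnd a m i) := by
  constructor
  · rintro ⟨hT, h⟩
    rw [hT.expo_eq_iff ha] at h
    have h1 : i + 1 ∉ T := by
      intro h1
      have := h (i + 1)
      have hne := fin_add_one_ne hN i
      rw [hT.expZ_eq_zero h1, expFst_apply ha] at this
      simp only [hne, add_sub_cancel_right, if_true, if_false] at this
      omega
    have h2 : i - 1 ∉ T := by
      intro h2
      have := h i
      rw [expFst_apply ha] at this
      simp only [expZ, hi, h1, h2, if_true, if_false] at this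
      split_ifs at this <;> omega
    have hT' := hT.insert hN h1 h2
    refine ⟨hT', (hT'.expo_eq_iff ha _).2 fun j => ?_⟩
    rw [expZ_insert hi, h, expFst_apply ha, expSnd_apply]
    ring
  · rintro ⟨hT', h⟩
    have hT := hT'.subset (Finset.subset_insert i T)
    refine ⟨hT, (hT.expo_eq_iff ha _).2 fun j => ?_⟩
    have := (hT'.expo_eq_iff ha _).1 h j
    rw [expZ_insert hi, expSnd_apply] at this
    rw [expFst_apply ha]
    linarith

end Independent

section Residue

variable {N : ℕ} [NeZero N] {a : Fin N → ℕ}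

theorem pderiv_loopW (j : Fin N) :
    pderiv j (loopW N a) =
      C (a j : ℂ) * X j ^ (a j - 1) * X (j + 1) + X (j - 1) ^ a (j - 1) := by
  have h : ∀ i : Fin N, pderiv j (X i ^ a i * X (i + 1) : MvPolynomial (Fin N) ℂ) =
      (if j = i then C (a i : ℂ) * X i ^ (a i - 1) * X (i + 1) else 0) +
        (if j - 1 = i then X i ^ a i else 0) := by
    intro i
    rw [pderiv_mul, pderiv_pow, pderiv_X, pderiv_X]
    simp only [Pi.single_apply, sub_eq_iff_eq_add, eq_comm (a := i), eq_comm (a := i + 1)]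
    split_ifs <;> simp
  simp only [loopW, map_sum, h, Finset.sum_add_distrib, Finset.sum_ite_eq, Finset.mem_univ,
    if_true]

theorem monomial_mul_pderiv (m : Fin N →₀ ℕ) (i : Fin N) :
    monomial m (1 : ℂ) * pderiv i (loopW N a) =
      monomial (expFst a m i) (a i : ℂ) + monomial (expSnd a m i) 1 := by
  rw [pderiv_loopW, X_pow_eq_monomial, X_pow_eq_monomial, X, C_mul_monomial, monomial_mul, mul_add,
    monomial_mul, monomial_mul]
  simp [expFst, expSnd]

open Classical in
/-- A linear functional that vanishes on the Jacobian ideal of the loop polynomial. -/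
noncomputable def residue (a : Fin N → ℕ) : MvPolynomial (Fin N) ℂ →ₗ[ℂ] ℂ :=
  ∑ T : Finset (Fin N), if Indep T then (∏ i ∈ T, -(a i : ℂ)) • lcoeff ℂ (expo a T) else 0

open Classical in
theorem residue_monomial (m : Fin N →₀ ℕ) (c : ℂ) :
    residue a (monomial m c) = ∑ T : Finset (Fin N),
      if Indep T ∧ expo a T = m then (∏ i ∈ T, -(a i : ℂ)) * c else 0 := by
  simp only [residue, LinearMap.sum_apply]
  refine Finset.sum_congr rfl fun T _ => ?_
  by_cases h : Indep T
  · by_cases h' : expo a T = m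
    · simp [h, h']
    · simp [h, h', Ne.symm h', coeff_monomial]
  · simp [h]

theorem residue_monomial_mul_pderiv (hN : 2 ≤ N) (ha : ∀ i, 2 ≤ a i) (m : Fin N →₀ ℕ)
    (i : Fin N) : residue a (monomial m 1 * pderiv i (loopW N a)) = 0 := by
  classical
  rw [monomial_mul_pderiv, map_add, residue_monomial, residue_monomial, ← Finset.sum_add_distrib,
    ← Finset.powerset_univ, ← Finset.insert_erase (Finset.mem_univ i),
    Finset.sum_powerset_insert (Finset.notMem_erase i _), ← Finset.sum_add_distrib]
  refine Finset.sum_eq_zero fun T hT => ?_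
  have hi : i ∉ T := fun h => Finset.notMem_erase i _ (Finset.mem_powerset.1 hT h)
  have h1 : ¬ (Indep T ∧ expo a T = expSnd a m i) := fun h => h.1.expo_ne_expSnd ha hi m h.2
  have h2 : ¬ (Indep (insert i T) ∧ expo a (insert i T) = expFst a m i) :=
    fun h => h.1.expo_ne_expFst ha (Finset.mem_insert_self i T) m h.2
  rw [if_neg h1, if_neg h2, add_zero, zero_add, if_congr (expo_insert_iff hN ha hi m) rfl rfl,
    Finset.prod_insert hi]
  split_ifs <;> ring

theorem residue_eq_zero (hN : 2 ≤ N) (ha : ∀ i, 2 ≤ a i) {p : MvPolynomial (Fin N) ℂ}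
    (hp : p ∈ jacIdeal (loopW N a)) : residue a p = 0 := by
  suffices h : ∀ q, residue a (q * p) = 0 by simpa using h 1
  induction hp using Submodule.span_induction with
  | mem x hx =>
    obtain ⟨i, rfl⟩ := hx
    intro q
    induction q using MvPolynomial.induction_on' with
    | monomial m c =>
      have : (monomial m c : MvPolynomial (Fin N) ℂ) = c • monomial m 1 := by simp [smul_monomial]
      rw [this, smul_mul_assoc, map_smul, residue_monomial_mul_pderiv hN ha, smul_zero]
    | add p q hp hq => rw [add_mul, map_add, hp, hq, add_zero]
  | zero => simp
  | add x y _ _ hx hy => intro q; rw [mul_add, map_add, hx, hy, add_zero]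
  | smul c x _ hx => intro q; rw [smul_eq_mul, ← mul_assoc]; exact hx _

theorem indep_empty : Indep (∅ : Finset (Fin N)) := fun j hj => by simp at hj

theorem residue_socle (ha : ∀ i, 2 ≤ a i) : residue a (monomial (expo a ∅) 1) = 1 := by
  classical
  rw [residue_monomial, Finset.sum_eq_single ∅]
  · simp [indep_empty]
  · rintro T - hne
    refine if_neg ?_
    rintro ⟨hT, h⟩
    obtain ⟨i, hi⟩ := Finset.nonempty_iff_ne_empty.2 hne
    have h1 := (hT.expo_eq_iff ha _).1 h (i - 1)
    have := ha (i - 1)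
    rw [indep_empty.expo_apply ha] at h1
    have h2 : i - 1 ∉ T := hT.sub_one_notMem hi
    simp only [expZ, sub_add_cancel, hi, h2, if_true, if_false, Finset.notMem_empty] at h1
    split_ifs at h1 <;> omega
  · simp

theorem mk_monomial_expo (hN : 2 ≤ N) (ha : ∀ i, 2 ≤ a i) {T : Finset (Fin N)} (hT : Indep T) :
    Ideal.Quotient.mk (jacIdeal (loopW N a)) (monomial (expo a T) 1) =
      (∏ i ∈ T, -(a i : ℂ)) •
        Ideal.Quotient.mk (jacIdeal (loopW N a)) (monomial (expo a ∅) 1) := by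
  classical
  induction T using Finset.induction_on with
  | empty => simp
  | insert i T hi ih =>
    have hle : Finsupp.single (i - 1) (a (i - 1)) ≤ expo a (insert i T) := by
      rw [Finsupp.single_le_iff, ← Nat.cast_le (α := ℤ), hT.expo_apply ha]
      have := ha (i - 1)
      have h1 : i - 1 ∉ insert i T := hT.sub_one_notMem (Finset.mem_insert_self i T)
      simp only [expZ, sub_add_cancel, h1, Finset.mem_insert_self, if_true, if_false]
      split_ifs <;> omega
    obtain ⟨m, hm⟩ := exists_add_of_le hle
    have hm' : expo a (insert i T) = expSnd a m i := by rw [hm, expSnd, add_comm]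
    have hT' := (expo_insert_iff hN ha hi m).2 ⟨hT, hm'⟩
    have hrel : Ideal.Quotient.mk (jacIdeal (loopW N a))
        (monomial (expFst a m i) (a i : ℂ) + monomial (expSnd a m i) 1) = 0 := by
      rw [← monomial_mul_pderiv, Ideal.Quotient.eq_zero_iff_mem]
      exact Ideal.mul_mem_left _ _ (Ideal.subset_span ⟨i, rfl⟩)
    have hc : (monomial (expFst a m i) (a i : ℂ) : MvPolynomial (Fin N) ℂ) =
      (a i : ℂ) • monomial (expFst a m i) 1 := by simp [smul_monomial]
    rw [map_add, hc, ← Ideal.Quotient.mkₐ_eq_mk ℂ, map_smul, Ideal.Quotient.mkₐ_eq_mk, ← hT'.2,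
      ← hm', ih hT'.1] at hrel
    rw [eq_neg_of_add_eq_zero_right hrel, Finset.prod_insert hi, smul_smul, ← neg_smul, neg_mul]

end Residue

section CyclicDet

open Equiv

variable {N : ℕ} {R : Type*} [CommRing R]

/-- The summand of the Leibniz formula for `det H` at `σ`. -/
def leibnizTerm (H : Matrix (Fin N) (Fin N) R) (σ : Perm (Fin N)) : R :=
  Perm.sign σ • ∏ i, H (σ i) i

theorem leibnizTerm_eq_zero {H : Matrix (Fin N) (Fin N) R} {σ : Perm (Fin N)} {i : Fin N}
    (h : H (σ i) i = 0) : leibnizTerm H σ = 0 := by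
  have h0 : ∏ j, H (σ j) j = 0 := Finset.prod_eq_zero (Finset.mem_univ i) h
  rw [leibnizTerm, h0, smul_zero]

variable [Algebra ℝ R] {H : Matrix (Fin N) (Fin N) R}

theorem leibnizTerm_one : leibnizTerm H 1 = (1 : ℝ) • ∏ i, H i i := by
  simp [leibnizTerm]

variable [NeZero N] {γ : Fin N → ℝ} {β : ℝ}

theorem leibnizTerm_of_transposed_pair (hN : 2 ≤ N)
    (hpair : ∀ i, H i (i + 1) * H (i + 1) i = -(γ i • (H i i * H (i + 1) (i + 1))))
    {σ : Perm (Fin N)} {i : Fin N} (h1 : σ i = i + 1) (h2 : σ (i + 1) = i) :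
    leibnizTerm H σ = γ i • leibnizTerm H (swap i (i + 1) * σ) := by
  have hne := fin_add_one_ne hN i
  have hsplit : ∀ f : Fin N → R, ∏ j, f j =
      f i * (f (i + 1) * ∏ j ∈ (Finset.univ.erase i).erase (i + 1), f j) := by
    intro f
    rw [Finset.mul_prod_erase _ _ (by simp [hne]), Finset.mul_prod_erase _ _ (by simp)]
  have hrest : ∏ j ∈ (Finset.univ.erase i).erase (i + 1), H ((swap i (i + 1) * σ) j) j =
      ∏ j ∈ (Finset.univ.erase i).erase (i + 1), H (σ j) j := by
    refine Finset.prod_congr rfl fun j hj => ?_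
    simp only [Finset.mem_erase, Finset.mem_univ, and_true] at hj
    rw [Perm.mul_apply, swap_apply_of_ne_of_ne]
    · rw [← h2]; exact fun h => hj.1 (σ.injective h)
    · rw [← h1]; exact fun h => hj.2 (σ.injective h)
  have e1 : (swap i (i + 1) * σ) i = i := by simp [h1]
  have e2 : (swap i (i + 1) * σ) (i + 1) = i + 1 := by simp [h2]
  rw [leibnizTerm, leibnizTerm, Perm.sign_mul, Perm.sign_swap hne.symm, hsplit, hsplit, hrest, e1,
    e2, h1, h2, ← mul_assoc, mul_comm (H (i + 1) i), hpair, ← mul_assoc]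
  rw [smul_comm (γ i), ← smul_mul_assoc]
  simp [Units.smul_def, mul_assoc]

theorem leibnizTerm_of_involutive (hN : 2 ≤ N)
    (hpair : ∀ i, H i (i + 1) * H (i + 1) i = -(γ i • (H i i * H (i + 1) (i + 1))))
    (hγ : ∀ i, 0 ≤ γ i) (σ : Perm (Fin N))
    (hloc : ∀ i, σ i = i ∨ σ i = i + 1 ∨ σ i = i - 1) (hinv : ∀ i, σ (σ i) = i) :
    ∃ c : ℝ, 0 ≤ c ∧ leibnizTerm H σ = c • ∏ i, H i i := by
  induction hn : σ.support.card using Nat.strong_induction_on generalizing σ with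
  | _ n ih =>
  by_cases h1 : σ = 1
  · exact ⟨1, zero_le_one, h1 ▸ leibnizTerm_one⟩
  obtain ⟨i, hi⟩ : ∃ i, σ i = i + 1 := by
    obtain ⟨j, hj⟩ : ∃ j, σ j ≠ j := by
      by_contra! h
      exact h1 (Equiv.ext h)
    rcases hloc j with h | h | h
    · exact absurd h hj
    · exact ⟨j, h⟩
    · exact ⟨j - 1, by rw [sub_add_cancel, ← h, hinv]⟩
  have hi' : σ (i + 1) = i := by rw [← hi, hinv]
  have hne := fin_add_one_ne hN i
  have hcard := Perm.card_support_swap_mul (f := σ) (x := i) (by rwa [hi])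
  rw [hi, hn] at hcard
  have e1 : (swap i (i + 1) * σ) i = i := by simp [hi]
  have e2 : (swap i (i + 1) * σ) (i + 1) = i + 1 := by simp [hi']
  have e3 : ∀ j, j ≠ i → j ≠ i + 1 → (swap i (i + 1) * σ) j = σ j := by
    intro j hj hj'
    rw [Perm.mul_apply, swap_apply_of_ne_of_ne]
    · rw [← hi']; exact fun h => hj' (σ.injective h)
    · rw [← hi]; exact fun h => hj (σ.injective h)
  obtain ⟨c, hc, h⟩ := ih _ hcard (swap i (i + 1) * σ) (by
      intro j
      by_cases hj : j = i
      · subst hj; exact Or.inl e1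
      by_cases hj' : j = i + 1
      · subst hj'; exact Or.inl e2
      rw [e3 j hj hj']
      exact hloc j) (by
      intro j
      by_cases hj : j = i
      · subst hj; rw [e1, e1]
      by_cases hj' : j = i + 1
      · subst hj'; rw [e2, e2]
      rw [e3 j hj hj', e3, hinv]
      · rw [← hi']; exact fun h => hj' (σ.injective h)
      · rw [← hi]; exact fun h => hj (σ.injective h)) rfl
  exact ⟨γ i * c, mul_nonneg (hγ i) hc, by
    rw [leibnizTerm_of_transposed_pair hN hpair hi hi', h, smul_smul]⟩

theorem involutive_or_shift (hN : 3 ≤ N) (σ : Perm (Fin N))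
    (hloc : ∀ i, σ i = i ∨ σ i = i + 1 ∨ σ i = i - 1) :
    (∀ i, σ (σ i) = i) ∨ σ = Equiv.addRight 1 ∨ σ = (Equiv.addRight 1)⁻¹ := by
  have hne : ∀ j : Fin N, j + 1 ≠ j := fin_add_one_ne (by omega)
  have hne2 : ∀ j : Fin N, j + 1 + 1 ≠ j := fin_add_one_add_one_ne hN
  by_cases hu : ∃ i, σ i = i + 1 ∧ σ (i + 1) = i + 1 + 1
  · obtain ⟨i, hi⟩ := hu
    have := fin_cyclic_induction (p := fun j => σ j = j + 1 ∧ σ (j + 1) = j + 1 + 1) hi (by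
      rintro j ⟨h1, h2⟩
      refine ⟨h2, ?_⟩
      rcases hloc (j + 1 + 1) with h | h | h
      · exact absurd (σ.injective (h.trans h2.symm)) (hne _)
      · exact h
      · rw [add_sub_cancel_right] at h
        exact absurd (σ.injective (h.trans h1.symm)) (hne2 _))
    exact Or.inr (Or.inl (Equiv.ext fun j => by simp [(this j).1]))
  by_cases hd : ∃ i, σ (i + 1) = i ∧ σ (i + 1 + 1) = i + 1
  · obtain ⟨i, hi⟩ := hd
    have := fin_cyclic_induction_down
      (p := fun j => σ (j + 1) = j ∧ σ (j + 1 + 1) = j + 1) hi (by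
      rintro j ⟨h1, h2⟩
      refine ⟨?_, h1⟩
      rcases hloc (j + 1) with h | h | h
      · exact absurd (σ.injective (h.trans h1.symm)) (hne _).symm
      · exact absurd (σ.injective (h.trans h2.symm)) (hne2 _).symm
      · rwa [add_sub_cancel_right] at h)
    refine Or.inr (Or.inr (Equiv.ext fun j => ?_))
    have h := (this (j - 1)).1
    rw [sub_add_cancel] at h
    rw [h, eq_comm, Perm.inv_eq_iff_eq]
    simp
  push Not at hu hd
  refine Or.inl fun i => ?_
  rcases hloc i with h | h | h
  · rw [h, h]
  · rw [h]
    rcases hloc (i + 1) with h' | h' | h'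
    · exact absurd (σ.injective (h'.trans h.symm)) (hne _)
    · exact absurd h' (hu i h)
    · rwa [add_sub_cancel_right] at h'
  · rw [h]
    rcases hloc (i - 1) with h' | h' | h'
    · have := hne (i - 1)
      rw [sub_add_cancel] at this
      exact absurd (σ.injective (h'.trans h.symm)) this.symm
    · rwa [sub_add_cancel] at h'
    · have := hd (i - 1 - 1)
      simp only [sub_add_cancel] at this
      exact absurd h (this h')

theorem neg_le_unit_mul {β : ℝ} (hβ : 0 ≤ β) (u : ℤˣ) : -β ≤ ((u : ℤ) : ℝ) * β := by
  rcases Int.units_eq_one_or u with rfl | rfl <;> simp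
  linarith

/-- A cyclic tridiagonal determinant, in case each pair of opposite off-diagonal entries
multiplies to a nonpositive multiple of the corresponding diagonal entries. -/
theorem exists_det_eq_smul (hN : 3 ≤ N)
    (hloc : ∀ i j, i ≠ j → i ≠ j + 1 → i ≠ j - 1 → H i j = 0)
    (hpair : ∀ i, H i (i + 1) * H (i + 1) i = -(γ i • (H i i * H (i + 1) (i + 1))))
    (hγ : ∀ i, 0 ≤ γ i) (hβ : 0 ≤ β)
    (hup : ∏ i, H (i + 1) i = β • ∏ i, H i i) (hdown : ∏ i, H i (i + 1) = β • ∏ i, H i i) :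
    ∃ c : ℝ, 1 + γ 0 - 2 * β ≤ c ∧ H.det = c • ∏ i, H i i := by
  have hN2 : 2 ≤ N := by omega
  have h01 : (0 : Fin N) + 1 ≠ 0 := fin_add_one_ne hN2 0
  have h02 : (0 : Fin N) + 1 + 1 ≠ 0 := fin_add_one_add_one_ne hN 0
  set u : Perm (Fin N) := Equiv.addRight 1 with hu
  set w : Perm (Fin N) := swap 0 (0 + 1) with hw
  have u0 : u 0 = 0 + 1 := rfl
  have u1 : u (0 + 1) = 0 + 1 + 1 := rfl
  have w0 : w 0 = 0 + 1 := swap_apply_left _ _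
  have w1 : w (0 + 1) = 0 := swap_apply_right _ _
  have v1 : u⁻¹ (0 + 1) = 0 := by rw [Perm.inv_eq_iff_eq, u0]
  have v2 : u⁻¹ (0 + 1 + 1) = 0 + 1 := by rw [Perm.inv_eq_iff_eq, u1]
  have w2 : w (0 + 1 + 1) = 0 + 1 + 1 :=
    swap_apply_of_ne_of_ne h02 (fin_add_one_ne hN2 _)
  have n1 : u ≠ 1 := fun h => h01 (by rw [← u0, h]; rfl)
  have n2 : u⁻¹ ≠ 1 := fun h => n1 (by simpa using h)
  have n3 : w ≠ 1 := fun h => h01 (by rw [← w0, h]; rfl)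
  have n4 : w ≠ u := fun h => h02 (by rw [← u1, ← h, w1])
  have n5 : w ≠ u⁻¹ := fun h => fin_add_one_ne hN2 (0 + 1) (by rw [← w2, h, v2])
  have n6 : u ≠ u⁻¹ := fun h => h02 (by rw [← u1, h, v1])
  have tu : leibnizTerm H u = ((Perm.sign u : ℤ) * β : ℝ) • ∏ i, H i i := by
    have : ∏ i, H (u i) i = ∏ i, H (i + 1) i := rfl
    rw [leibnizTerm, this, hup, ← smul_smul, Units.smul_def, Int.cast_smul_eq_zsmul]
  have tv : leibnizTerm H u⁻¹ = ((Perm.sign u⁻¹ : ℤ) * β : ℝ) • ∏ i, H i i := by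
    have : ∏ i, H (u⁻¹ i) i = ∏ i, H i (i + 1) := by
      rw [← Equiv.prod_comp u]
      simp [hu]
    rw [leibnizTerm, this, hdown, ← smul_smul, Units.smul_def, Int.cast_smul_eq_zsmul]
  have tw : leibnizTerm H w = γ 0 • ∏ i, H i i := by
    rw [leibnizTerm_of_transposed_pair hN2 hpair w0 w1, hw, swap_mul_self, leibnizTerm_one,
      one_smul]
  have hex : ∀ σ : Perm (Fin N), ∃ c : ℝ, leibnizTerm H σ = c • ∏ i, H i i ∧
      (σ = 1 → c = 1) ∧ (σ = w → c = γ 0) ∧ (σ = u → -β ≤ c) ∧ (σ = u⁻¹ → -β ≤ c) ∧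
      (σ ≠ u → σ ≠ u⁻¹ → 0 ≤ c) := by
    intro σ
    by_cases h1 : σ = 1
    · subst h1
      exact ⟨1, leibnizTerm_one, fun _ => rfl, fun h => absurd h.symm n3,
        fun h => absurd h.symm n1, fun h => absurd h.symm n2, fun _ _ => zero_le_one⟩
    by_cases h2 : σ = w
    · exact ⟨γ 0, h2 ▸ tw, fun h => absurd h h1, fun _ => rfl, fun h => absurd (h2.symm.trans h) n4,
        fun h => absurd (h2.symm.trans h) n5, fun _ _ => hγ 0⟩
    by_cases h3 : σ = u
    · exact ⟨_, h3 ▸ tu, fun h => absurd h h1, fun h => absurd h h2,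
        fun _ => neg_le_unit_mul hβ _, fun _ => neg_le_unit_mul hβ _, fun h => absurd h3 h⟩
    by_cases h4 : σ = u⁻¹
    · exact ⟨_, h4 ▸ tv, fun h => absurd h h1, fun h => absurd h h2,
        fun h => absurd h h3, fun _ => neg_le_unit_mul hβ _, fun _ h => absurd h4 h⟩
    suffices h : ∃ c : ℝ, 0 ≤ c ∧ leibnizTerm H σ = c • ∏ i, H i i by
      obtain ⟨c, hc, h⟩ := h
      exact ⟨c, h, fun h => absurd h h1, fun h => absurd h h2, fun h => absurd h h3,
        fun h => absurd h h4, fun _ _ => hc⟩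
    by_cases hl : ∀ i, σ i = i ∨ σ i = i + 1 ∨ σ i = i - 1
    · rcases involutive_or_shift hN σ hl with h | h | h
      · exact leibnizTerm_of_involutive hN2 hpair hγ σ hl h
      · exact absurd h h3
      · exact absurd h h4
    · push Not at hl
      obtain ⟨i, hi1, hi2, hi3⟩ := hl
      exact ⟨0, le_rfl, by rw [leibnizTerm_eq_zero (hloc _ _ hi1 hi2 hi3), zero_smul]⟩
  choose f hf f1 fw fu fv f0 using hex
  refine ⟨∑ σ, f σ, ?_, ?_⟩
  · have h := Finset.sum_le_sum_of_subset_of_nonneg (f := f)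
      (Finset.subset_univ ({1, w, u, u⁻¹} : Finset (Perm (Fin N)))) (by
        intro σ _ hσ
        simp only [Finset.mem_insert, Finset.mem_singleton, not_or] at hσ
        exact f0 σ hσ.2.2.1 hσ.2.2.2)
    rw [Finset.sum_insert (by simp [n1.symm, n2.symm, n3.symm, -one_eq_inv]),
      Finset.sum_insert (by simp [n4, n5]), Finset.sum_insert (by simpa using n6),
      Finset.sum_singleton, f1 1 rfl, fw w rfl] at h
    have := fu u rfl
    have := fv u⁻¹ rfl
    linarith
  · rw [Matrix.det_apply, Finset.sum_smul]
    exact Finset.sum_congr rfl fun σ _ => hf σ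

end CyclicDet

section Hessian

variable {N : ℕ} [NeZero N] {a : Fin N → ℕ}

theorem pderiv_pderiv_loopW (i j : Fin N) :
    pderiv i (pderiv j (loopW N a)) =
      (if i = j then (a j : MvPolynomial (Fin N) ℂ) * ((a j - 1 : ℕ) : MvPolynomial (Fin N) ℂ) *
        (X j ^ (a j - 2) * X (j + 1)) else 0) +
      (if i = j + 1 then (a j : MvPolynomial (Fin N) ℂ) * X j ^ (a j - 1) else 0) +
      (if i = j - 1 then (a (j - 1) : MvPolynomial (Fin N) ℂ) * X (j - 1) ^ (a (j - 1) - 1)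
        else 0) := by
  rw [pderiv_loopW, map_natCast, mul_assoc, map_add, pderiv_mul, pderiv_mul, pderiv_pow,
    pderiv_pow, pderiv_X, pderiv_X, pderiv_X, ← map_natCast (C : ℂ →+* _) (a j), pderiv_C]
  simp only [Pi.single_apply, eq_comm (a := j), eq_comm (a := j + 1), eq_comm (a := j - 1),
    Nat.sub_sub]
  split_ifs <;> simp <;> ring

/-- `x` is a common zero of the partial derivatives of the loop polynomial. -/
def IsCritical {R : Type*} [CommRing R] (a : Fin N → ℕ) (x : Fin N → R) : Prop :=
  ∀ i, x i ^ a i = -((a (i + 1) : R) * x (i + 1) ^ (a (i + 1) - 1) * x (i + 1 + 1))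

theorem isCritical_mk :
    IsCritical a fun i => Ideal.Quotient.mk (jacIdeal (loopW N a)) (X i) := by
  intro i
  have h : Ideal.Quotient.mk (jacIdeal (loopW N a)) (pderiv (i + 1) (loopW N a)) = 0 :=
    Ideal.Quotient.eq_zero_iff_mem.2 (Ideal.subset_span ⟨i + 1, rfl⟩)
  rw [pderiv_loopW, add_sub_cancel_right, map_natCast] at h
  simp only [map_add, map_mul, map_pow, map_natCast] at h
  exact eq_neg_of_add_eq_zero_right h

variable {R : Type*} [CommRing R] {x : Fin N → R}

theorem IsCritical.sq_pow (hx : IsCritical a x) (ha : ∀ i, 2 ≤ a i) (i : Fin N) :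
    x i ^ (a i - 1) * x i ^ (a i - 1) = -((a (i + 1) : R) *
      (x i ^ (a i - 2) * x (i + 1) ^ (a (i + 1) - 1) * x (i + 1 + 1))) := by
  have := ha i
  rw [← pow_add, show a i - 1 + (a i - 1) = a i - 2 + a i by omega, pow_add, hx i]
  ring

theorem prod_inv_le_pair (hN : 2 ≤ N) {b : Fin N → ℝ} (hb : ∀ i, 1 ≤ b i) :
    ∏ i, (b i)⁻¹ ≤ (b 0 * b (0 + 1))⁻¹ := by
  have hne := fin_add_one_ne hN 0
  have hpos : ∀ i, 0 ≤ (b i)⁻¹ := fun i => inv_nonneg.2 (zero_le_one.trans (hb i))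
  rw [← Finset.mul_prod_erase _ _ (Finset.mem_univ 0),
    ← Finset.mul_prod_erase _ _ (show (0 + 1 : Fin N) ∈ Finset.univ.erase 0 by simpa using hne),
    ← mul_assoc, mul_inv]
  refine mul_le_of_le_one_right (mul_nonneg (hpos _) (hpos _)) ?_
  exact Finset.prod_le_one (fun i _ => hpos i) fun i _ => inv_le_one_of_one_le₀ (hb i)

variable [Algebra ℝ R]

theorem IsCritical.exists_det_eq (hN : 3 ≤ N) (ha : ∀ i, 2 ≤ a i) (hx : IsCritical a x)
    {H : Matrix (Fin N) (Fin N) R}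
    (hH : ∀ i j, H i j = (if i = j then (a j : R) * ((a j - 1 : ℕ) : R) *
        (x j ^ (a j - 2) * x (j + 1)) else 0) +
      (if i = j + 1 then (a j : R) * x j ^ (a j - 1) else 0) +
      (if i = j - 1 then (a (j - 1) : R) * x (j - 1) ^ (a (j - 1) - 1) else 0)) :
    ∃ c : ℝ, 0 < c ∧ H.det = c • ∏ i, x i ^ (a i - 1) := by
  have hne : ∀ j : Fin N, j + 1 ≠ j := fin_add_one_ne (by omega)
  have hne2 : ∀ j : Fin N, j + 1 + 1 ≠ j := fin_add_one_add_one_ne hN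
  have hdiag : ∀ i, H i i = (a i : R) * ((a i - 1 : ℕ) : R) * (x i ^ (a i - 2) * x (i + 1)) := by
    intro i
    have h1 : i ≠ i - 1 := fun h => hne i (eq_sub_iff_add_eq.1 h)
    simp [hH, (hne i).symm, h1]
  have hlow : ∀ i, H (i + 1) i = (a i : R) * x i ^ (a i - 1) := by
    intro i
    have h1 : i + 1 ≠ i - 1 := fun h => hne2 i (eq_sub_iff_add_eq.1 h)
    simp [hH, hne i, h1, -add_eq_left]
  have hupp : ∀ i, H i (i + 1) = (a i : R) * x i ^ (a i - 1) := by
    intro i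
    simp [hH, (hne i).symm, (hne2 i).symm, -left_eq_add]
  set b : Fin N → ℝ := fun i => ((a i - 1 : ℕ) : ℝ) with hb
  have hb1 : ∀ i, 1 ≤ b i := fun i => by
    have := ha i
    simp only [hb, Nat.one_le_cast]
    omega
  have hb0 : ∀ i, b i ≠ 0 := fun i => (zero_lt_one.trans_le (hb1 i)).ne'
  set A : ℝ := ∏ i, (a i : ℝ) with hA
  have hApos : 0 < A := Finset.prod_pos fun i _ => by have := ha i; positivity
  have hBpos : 0 < ∏ i, b i := Finset.prod_pos fun i _ => zero_lt_one.trans_le (hb1 i)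
  have hshift : ∏ i, x (i + 1) = ∏ i, x i := Equiv.prod_comp (Equiv.addRight (1 : Fin N)) x
  have hD : ∏ i, H i i = (A * ∏ i, b i) • ∏ i, x i ^ (a i - 1) := by
    have h1 : ∏ i, x i ^ (a i - 1) = ∏ i, (x i ^ (a i - 2) * x (i + 1)) := by
      rw [Finset.prod_mul_distrib, hshift, ← Finset.prod_mul_distrib]
      refine Finset.prod_congr rfl fun i _ => ?_
      have := ha i
      rw [← pow_succ, show a i - 2 + 1 = a i - 1 by omega]
    simp only [h1, hdiag, Finset.prod_mul_distrib, hA, hb, Algebra.smul_def, map_prod,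
      map_natCast, map_mul]
  have hoff : ∏ i, ((a i : R) * x i ^ (a i - 1)) = (∏ i, (b i)⁻¹) • ∏ i, H i i := by
    rw [hD, smul_smul, Finset.prod_inv_distrib, mul_comm A, inv_mul_cancel_left₀ hBpos.ne',
      Finset.prod_mul_distrib, Algebra.smul_def, hA, map_prod]
    simp
  have hpair : ∀ i, H i (i + 1) * H (i + 1) i =
      -(((a i : ℝ) / (b i * b (i + 1))) • (H i i * H (i + 1) (i + 1))) := by
    intro i
    have h1 : x (i + 1) ^ (a (i + 1) - 1) = x (i + 1) * x (i + 1) ^ (a (i + 1) - 2) := by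
      have := ha (i + 1)
      rw [← pow_succ', show a (i + 1) - 2 + 1 = a (i + 1) - 1 by omega]
    have h2 : H i i * H (i + 1) (i + 1) = ((a i : ℝ) * a (i + 1) * (b i * b (i + 1))) •
        (x i ^ (a i - 2) * x (i + 1) ^ (a (i + 1) - 1) * x (i + 1 + 1)) := by
      rw [hdiag, hdiag, h1]
      simp only [hb, Algebra.smul_def, map_natCast, map_mul]
      ring
    have h3 : (a i : ℝ) / (b i * b (i + 1)) * ((a i : ℝ) * a (i + 1) * (b i * b (i + 1))) =
        a i * a i * a (i + 1) := by
      have := hb0 i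
      have := hb0 (i + 1)
      field_simp
    rw [h2, smul_smul, h3, hupp, hlow, mul_mul_mul_comm, hx.sq_pow ha]
    simp only [Algebra.smul_def, map_natCast, map_mul]
    ring
  obtain ⟨c, hc, hdet⟩ := exists_det_eq_smul (γ := fun i => (a i : ℝ) / (b i * b (i + 1)))
    (β := ∏ i, (b i)⁻¹) hN (fun i j h1 h2 h3 => by simp [hH, h1, h2, h3]) hpair
    (fun i => by
      have := hb1 i
      have := hb1 (i + 1)
      positivity)
    (Finset.prod_nonneg fun i _ => inv_nonneg.2 (zero_le_one.trans (hb1 i)))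
    (by rw [← hoff]; exact Finset.prod_congr rfl fun i _ => hlow i)
    (by rw [← hoff]; exact Finset.prod_congr rfl fun i _ => hupp i)
  refine ⟨c * (A * ∏ i, b i), mul_pos ?_ (mul_pos hApos hBpos), by rw [hdet, hD, smul_smul]⟩
  have h1 := prod_inv_le_pair (by omega) hb1
  have h2 : 2 * (b 0 * b (0 + 1))⁻¹ ≤ (a 0 : ℝ) / (b 0 * b (0 + 1)) := by
    rw [div_eq_mul_inv]
    have h3 := hb1 0
    have h4 := hb1 (0 + 1)
    have : (2 : ℝ) ≤ a 0 := by exact_mod_cast ha 0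
    gcongr
  linarith

theorem IsCritical.exists_det_eq_two {a : Fin 2 → ℕ} {x : Fin 2 → R} (ha : ∀ i, 2 ≤ a i)
    (hx : IsCritical a x) {H : Matrix (Fin 2) (Fin 2) R}
    (hH : ∀ i j, H i j = (if i = j then (a j : R) * ((a j - 1 : ℕ) : R) *
        (x j ^ (a j - 2) * x (j + 1)) else 0) +
      (if i = j + 1 then (a j : R) * x j ^ (a j - 1) else 0) +
      (if i = j - 1 then (a (j - 1) : R) * x (j - 1) ^ (a (j - 1) - 1) else 0)) :
    ∃ c : ℝ, 0 < c ∧ H.det = c • ∏ i, x i ^ (a i - 1) := by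
  have e1 : (0 : Fin 2) + 1 = 1 := rfl
  have e2 : (1 : Fin 2) + 1 = 0 := rfl
  have e3 : (0 : Fin 2) - 1 = 1 := rfl
  have e4 : (1 : Fin 2) - 1 = 0 := rfl
  have h0 := hx.sq_pow ha 0
  have h1 := hx.sq_pow ha 1
  rw [e1, e2] at h0
  rw [e2, e1] at h1
  rw [Matrix.det_fin_two, Fin.prod_univ_two]
  simp only [hH, e1, e2, e3, e4, if_true, zero_ne_one, one_ne_zero, if_false, add_zero, zero_add]
  have ha0 := ha 0
  have ha1 := ha 1
  obtain ⟨p, hp⟩ := Nat.exists_eq_add_of_le ha0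
  obtain ⟨q, hq⟩ := Nat.exists_eq_add_of_le ha1
  rw [hp, hq] at h0 h1 ⊢
  simp only [show 2 + p - 1 = p + 1 by omega, show 2 + q - 1 = q + 1 by omega,
    show 2 + p - 2 = p by omega, show 2 + q - 2 = q by omega] at h0 h1 ⊢
  refine ⟨(2 + p) * (2 + q) * ((2 + p) * (2 + q) - 1), ?_, ?_⟩
  · have : (0 : ℝ) ≤ p := p.cast_nonneg
    have : (0 : ℝ) ≤ q := q.cast_nonneg
    refine mul_pos (by positivity) ?_
    nlinarith [mul_nonneg ‹(0 : ℝ) ≤ p› ‹(0 : ℝ) ≤ q›]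
  · rw [Algebra.smul_def]
    simp only [map_mul, map_add, map_sub, map_natCast, map_ofNat, map_one]
    push_cast at h0 h1 ⊢
    linear_combination (-(2 + p : R) ^ 2) * h0 - (2 + q : R) ^ 2 * h1

theorem prod_pow_eq_monomial_expo (ha : ∀ i, 2 ≤ a i) {e : Fin N → ℕ} {T : Finset (Fin N)}
    (hT : Indep T) (h : ∀ i, (e i : ℤ) = expZ a T i) :
    (∏ i, X i ^ e i : MvPolynomial (Fin N) ℂ) = monomial (expo a T) 1 := by
  rw [monomial_eq, Finsupp.prod_fintype _ _ (fun i => pow_zero _), map_one, one_mul]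
  refine Finset.prod_congr rfl fun i _ => ?_
  have := hT.expo_apply ha i
  rw [← h, Nat.cast_inj] at this
  rw [this]

/-- In the Milnor ring, the Hessian of a loop polynomial is a nonzero multiple of
`∏ X i ^ (a i - 1)`. -/
theorem mk_hess (hN : 2 ≤ N) (ha : ∀ i, 2 ≤ a i) :
    ∃ c : ℂ, c ≠ 0 ∧ Ideal.Quotient.mk (jacIdeal (loopW N a)) (hess (loopW N a)) =
      c • Ideal.Quotient.mk (jacIdeal (loopW N a)) (monomial (expo a ∅) 1) := by
  have key : ∃ c : ℝ, 0 < c ∧ ((Ideal.Quotient.mk (jacIdeal (loopW N a))).mapMatrix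
      (Matrix.of fun i j => pderiv i (pderiv j (loopW N a)))).det =
        c • ∏ i, (Ideal.Quotient.mk (jacIdeal (loopW N a)) (X i)) ^ (a i - 1) := by
    rcases hN.eq_or_lt with rfl | hN
    · refine (isCritical_mk (a := a)).exists_det_eq_two ha fun i j => ?_
      rw [RingHom.mapMatrix_apply, Matrix.map_apply, Matrix.of_apply, pderiv_pderiv_loopW]
      simp only [map_add, apply_ite (Ideal.Quotient.mk (jacIdeal (loopW _ a))), map_mul, map_pow,
        map_natCast, map_zero]
    · refine (isCritical_mk (a := a)).exists_det_eq hN ha fun i j => ?_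
      rw [RingHom.mapMatrix_apply, Matrix.map_apply, Matrix.of_apply, pderiv_pderiv_loopW]
      simp only [map_add, apply_ite (Ideal.Quotient.mk (jacIdeal (loopW _ a))), map_mul, map_pow,
        map_natCast, map_zero]
  obtain ⟨c, hc, h⟩ := key
  refine ⟨c, by exact_mod_cast hc.ne', ?_⟩
  have hm : (∏ i, X i ^ (a i - 1) : MvPolynomial (Fin N) ℂ) = monomial (expo a ∅) 1 :=
    prod_pow_eq_monomial_expo ha indep_empty fun i => by
      have := ha i
      simp only [expZ, Finset.notMem_empty, if_false]
      omega
  rw [hess, RingHom.map_det, h, ← hm, map_prod, ← Complex.coe_smul]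
  simp only [map_pow]

end Hessian

section Integrality

variable {N : ℕ} [NeZero N] {a : Fin N → ℕ}

theorem loopMatrixQ_apply (hN : 2 ≤ N) (i j : Fin N) :
    loopMatrixQ N a i j = (if i = j then (a j : ℚ) else 0) + (if i = j - 1 then 1 else 0) := by
  have := fin_add_one_ne hN i
  simp only [loopMatrixQ, Matrix.of_apply, eq_sub_iff_add_eq, eq_comm (a := j)]
  by_cases h : i = j
  · subst h; simp [this, -add_eq_left]
  · simp [h]

theorem transpose_mulVec (hN : 2 ≤ N) (k : Fin N → ℚ) (j : Fin N) :
    (loopMatrixQ N a).transpose.mulVec k j = a j * k j + k (j - 1) := by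
  simp [Matrix.mulVec, dotProduct, loopMatrixQ_apply hN, add_mul, Finset.sum_add_distrib]

theorem isUnit_det_transpose (hN : 2 ≤ N) (ha : ∀ i, 2 ≤ a i) :
    IsUnit (loopMatrixQ N a).transpose.det := by
  rw [isUnit_iff_ne_zero]
  intro h
  obtain ⟨k, hk, h0⟩ := Matrix.exists_mulVec_eq_zero_iff.2 h
  obtain ⟨j, hj⟩ := Finite.exists_max fun i => |k i|
  have h1 := congrFun h0 j
  rw [transpose_mulVec hN, Pi.zero_apply, add_eq_zero_iff_eq_neg] at h1
  have h2 := congrArg abs h1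
  rw [abs_mul, abs_neg, Nat.abs_cast] at h2
  have h3 := hj (j - 1)
  have h4 : (2 : ℚ) ≤ a j := by exact_mod_cast ha j
  have h5 : |k j| ≤ 0 := by nlinarith [abs_nonneg (k j)]
  exact hk (funext fun i => abs_nonpos_iff.1 ((hj i).trans h5))

theorem integral_iff (hN : 2 ≤ N) (ha : ∀ i, 2 ≤ a i) (e : Fin N → ℕ) :
    (∀ i : Fin N, ∃ z : ℤ,
      ((loopMatrixQ N a).transpose⁻¹.mulVec (fun j => (e j : ℚ) + 2)) i = z) ↔
    ∃ k : Fin N → ℤ, ∀ j, a j * k j + k (j - 1) = e j + 2 := by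
  have hu := isUnit_det_transpose hN ha
  constructor
  · intro h
    choose k hk using h
    refine ⟨k, fun j => ?_⟩
    have h1 : (loopMatrixQ N a).transpose.mulVec (fun i => (k i : ℚ)) j = e j + 2 := by
      rw [← funext hk, Matrix.mulVec_mulVec, Matrix.mul_nonsing_inv _ hu, Matrix.one_mulVec]
    rw [transpose_mulVec hN] at h1
    exact_mod_cast h1
  · rintro ⟨k, hk⟩ i
    refine ⟨k i, ?_⟩
    have h1 : (fun j => (e j : ℚ) + 2) =
        (loopMatrixQ N a).transpose.mulVec (fun i => (k i : ℚ)) := by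
      funext j
      rw [transpose_mulVec hN]
      exact_mod_cast (hk j).symm
    rw [h1, Matrix.mulVec_mulVec, Matrix.nonsing_inv_mul _ hu, Matrix.one_mulVec]

theorem expZ_spec (T : Finset (Fin N)) (j : Fin N) :
    (a j : ℤ) * (1 + (if j + 1 ∈ T then 1 else 0) - (if j ∈ T then 1 else 0)) +
      (1 + (if j - 1 + 1 ∈ T then 1 else 0) - (if j - 1 ∈ T then 1 else 0)) =
        expZ a T j + 2 := by
  rw [expZ, sub_add_cancel]
  split_ifs <;> ring

theorem mem_zero_one_two (ha : ∀ i, 2 ≤ a i) {k : Fin N → ℤ}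
    (hlow : ∀ j, 2 ≤ a j * k j + k (j - 1)) (hup : ∀ j, a j * k j + k (j - 1) ≤ 2 * a j)
    (j : Fin N) : k j = 0 ∨ k j = 1 ∨ k j = 2 := by
  obtain ⟨p, hp⟩ := Finite.exists_max k
  obtain ⟨q, hq⟩ := Finite.exists_min k
  have h1 := hup p
  have h2 := hlow q
  have h3 := hq (p - 1)
  have h4 := hp (q - 1)
  have hap : (2 : ℤ) ≤ a p := by exact_mod_cast ha p
  have haq : (2 : ℤ) ≤ a q := by exact_mod_cast ha q
  have hmax : k p ≤ 2 := by
    by_contra! h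
    have h5 : 2 * (k p - 2) ≤ -k q := by nlinarith
    have h6 : 2 * -k q ≤ k p - 2 := by nlinarith
    omega
  have hmin : 0 ≤ k q := by
    by_contra! h
    have h6 : 2 * -k q ≤ k p - 2 := by nlinarith
    omega
  have := hp j
  have := hq j
  omega

/-- The integral vectors with image under the transposed exponent matrix in the box
`[2, 2 a j]` are the constant vector `1` and the alternating vectors of `0` and `2`. -/
theorem exists_indep_of_integral (ha : ∀ i, 2 ≤ a i) {k : Fin N → ℤ} {e : Fin N → ℕ}
    (he : ∀ j, e j ≤ 2 * (a j - 1)) (hk : ∀ j, a j * k j + k (j - 1) = e j + 2) :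
    ∃ T : Finset (Fin N), Indep T ∧ ∀ j, (e j : ℤ) = expZ a T j := by
  have hup : ∀ j, a j * k j + k (j - 1) ≤ 2 * a j := fun j => by
    have := ha j
    have := he j
    rw [hk]
    omega
  have hlow : ∀ j, 2 ≤ a j * k j + k (j - 1) := fun j => by
    rw [hk]
    omega
  have h012 := mem_zero_one_two ha hlow hup
  have hzero : ∀ j, k j = 0 → k (j - 1) = 2 := fun j hj => by
    have h1 := hlow j
    rw [hj] at h1
    have := h012 (j - 1)
    omega
  have htwo : ∀ j, k j = 2 → k (j - 1) = 0 := fun j hj => by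
    have h1 := hup j
    rw [hj] at h1
    have := h012 (j - 1)
    omega
  suffices h : ∃ T : Finset (Fin N), Indep T ∧
      ∀ j, k j = 1 + (if j + 1 ∈ T then 1 else 0) - (if j ∈ T then 1 else 0) by
    obtain ⟨T, hT, h⟩ := h
    refine ⟨T, hT, fun j => ?_⟩
    have := hk j
    rw [h j, h (j - 1), expZ_spec] at this
    omega
  by_cases h1 : ∃ i, k i ≠ 1
  · obtain ⟨i, hi⟩ := h1
    have halt := fin_cyclic_induction_down (i := i) (p := fun j => k j = 0 ∨ k j = 2)
      (by have := h012 i; omega) (fun j hj => by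
        have h0 := hzero (j + 1)
        have h2 := htwo (j + 1)
        rw [add_sub_cancel_right] at h0 h2
        tauto)
    have hstep : ∀ j, k j = 0 ↔ k (j + 1) = 2 := fun j => by
      have h0 := hzero (j + 1)
      have h2 := htwo (j + 1)
      rw [add_sub_cancel_right] at h0 h2
      have := halt (j + 1)
      omega
    refine ⟨Finset.univ.filter fun j => k j = 0, fun j hj => ?_, fun j => ?_⟩
    · simp only [Finset.mem_filter, Finset.mem_univ, true_and] at hj ⊢
      rw [hstep] at hj
      omega
    · simp only [Finset.mem_filter, Finset.mem_univ, true_and]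
      have h1 := hstep j
      have h2 := halt j
      have h3 := halt (j + 1)
      split_ifs <;> omega
  · push Not at h1
    exact ⟨∅, indep_empty, by simpa using h1⟩

theorem exists_indep_of_residue_ne_zero {m : Fin N →₀ ℕ} (h : residue a (monomial m 1) ≠ 0) :
    ∃ T : Finset (Fin N), Indep T ∧ expo a T = m := by
  rw [residue_monomial] at h
  obtain ⟨T, -, hT⟩ := Finset.exists_ne_zero_of_sum_ne_zero h
  exact ⟨T, by_contra fun h => hT (if_neg h)⟩

theorem mk_monomial_eq_smul_hess_iff (hN : 2 ≤ N) (ha : ∀ i, 2 ≤ a i) (e : Fin N → ℕ) :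
    (∃ c : ℂ, c ≠ 0 ∧
      Ideal.Quotient.mk (jacIdeal (loopW N a)) (∏ i : Fin N, X i ^ e i) =
        c • Ideal.Quotient.mk (jacIdeal (loopW N a)) (hess (loopW N a))) ↔
    ∃ T : Finset (Fin N), Indep T ∧ ∀ j, (e j : ℤ) = expZ a T j := by
  obtain ⟨d, hd, hhess⟩ := mk_hess hN ha
  constructor
  · rintro ⟨c, hc, h⟩
    have he : (∏ i, X i ^ e i : MvPolynomial (Fin N) ℂ) =
        monomial (Finsupp.equivFunOnFinite.symm e) 1 := by
      rw [monomial_eq, Finsupp.prod_fintype _ _ (fun i => pow_zero _), map_one, one_mul]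
      rfl
    rw [hhess, smul_smul, he, ← Ideal.Quotient.mkₐ_eq_mk ℂ, ← map_smul, Ideal.Quotient.mkₐ_eq_mk,
      Ideal.Quotient.eq] at h
    have hres := residue_eq_zero hN ha h
    rw [map_sub, map_smul, residue_socle ha, sub_eq_zero] at hres
    obtain ⟨T, hT, hTe⟩ := exists_indep_of_residue_ne_zero
      (a := a) (m := Finsupp.equivFunOnFinite.symm e) (by
        rw [hres, smul_eq_mul, mul_one]
        exact mul_ne_zero hc hd)
    exact ⟨T, hT, fun j => ((hT.expo_eq_iff ha _).1 hTe j).symm⟩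
  · rintro ⟨T, hT, h⟩
    have hprod : (∏ i ∈ T, -(a i : ℂ)) ≠ 0 := Finset.prod_ne_zero_iff.2 fun i _ => by
      have := ha i
      rw [neg_ne_zero, Nat.cast_ne_zero]
      omega
    refine ⟨(∏ i ∈ T, -(a i : ℂ)) * d⁻¹, mul_ne_zero hprod (inv_ne_zero hd), ?_⟩
    rw [prod_pow_eq_monomial_expo ha hT h, mk_monomial_expo hN ha hT, hhess, smul_smul, mul_assoc,
      inv_mul_cancel₀ hd, mul_one]

end Integrality

end LoopPoly

/-- For exponent vectors `r`, `s` with `0 ≤ r i, s i ≤ a i - 1`, the vector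
`(Mᵀ)⁻¹ (r + s + 2·𝟙)` is integral if and only if the image of `∏ X i ^ (r i + s i)`
in the Milnor ring is a nonzero scalar multiple of the image of the Hessian. -/
theorem loop_hess_equiv (N : ℕ) [NeZero N] (hN : 2 ≤ N) (a : Fin N → ℕ)
    (ha : ∀ i, 2 ≤ a i) (r s : Fin N → ℕ)
    (hr : ∀ i, r i ≤ a i - 1) (hs : ∀ i, s i ≤ a i - 1) :
    (∀ i : Fin N, ∃ z : ℤ,
      ((loopMatrixQ N a).transpose⁻¹.mulVec (fun j => (r j : ℚ) + s j + 2)) i = z) ↔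
    (∃ c : ℂ, c ≠ 0 ∧
      Ideal.Quotient.mk (jacIdeal (loopW N a)) (∏ i : Fin N, X i ^ (r i + s i)) =
        c • Ideal.Quotient.mk (jacIdeal (loopW N a)) (hess (loopW N a))) := by
  have h := LoopPoly.integral_iff hN ha fun i => r i + s i
  simp only [Nat.cast_add] at h
  rw [h, LoopPoly.mk_monomial_eq_smul_hess_iff hN ha fun i => r i + s i]
  constructor
  · rintro ⟨k, hk⟩
    refine LoopPoly.exists_indep_of_integral ha (fun j => ?_) (k := k) (fun j => ?_)
    · have := hr j
      have := hs j
      omega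
    · rw [hk, Nat.cast_add]
  · rintro ⟨T, -, hT⟩
    refine ⟨fun j => 1 + (if j + 1 ∈ T then 1 else 0) - (if j ∈ T then 1 else 0), fun j => ?_⟩
    rw [LoopPoly.expZ_spec, ← hT, Nat.cast_add]
end
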